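/- arXiv:1701.02219 — 2 statements merged into one kernel-verified Lean document; each statement's English description precedes it below -/
import Mathlib

section
/- Let k, ℓ, n be natural numbers with ℓ < k and n < k, and let q(x) = Q^k_ℓ(i·x), r(x) = Q^k_n(i·x). Then the boundary term of the Lagrange identity vanishes at infinity: (1+x²)·(r(x)·q'(x) − q(x)·r'(x)) → 0 as x → +∞ and as x → −∞. -/
open MeasureTheory Filter Finset

/-- Legendre polynomial of the first kind via the Rodrigues formula,
evaluated at a complex argument. -/
noncomputable def legP (l : ℕ) (z : ℂ) : ℂ :=
  (1 / (2 ^ l * (l.factorial : ℂ))) * iteratedDeriv l (fun w : ℂ => (w ^ 2 - 1) ^ l) z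

/-- Legendre function of the second kind `Q_ℓ` (Ferrers branch), for complex argument. -/
noncomputable def legQ (l : ℕ) (z : ℂ) : ℂ :=
  (1 / 2) * legP l z * Complex.log ((1 + z) / (1 - z)) -
    ∑ j ∈ Finset.Icc 1 l, legP (j - 1) z * legP (l - j) z / (j : ℂ)

/-- The associated Legendre function of the second kind on the imaginary axis:
`Q^k_ℓ(i·x) = (−1)^k (1+x²)^{k/2} i^{−k} (d/dx)^k [Q_ℓ(i·x)]`. -/
noncomputable def Qi (k l : ℕ) (x : ℝ) : ℂ :=
  (-1) ^ k * (((1 + x ^ 2) ^ ((k : ℝ) / 2) : ℝ) : ℂ) * Complex.I ^ (-(k : ℤ)) *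
    iteratedDeriv k (fun t : ℝ => legQ l (Complex.I * t)) x

open Polynomial

/-- The Legendre polynomial of degree `l`, by the Rodrigues formula. -/
noncomputable def legendrePoly (l : ℕ) : ℂ[X] :=
  C (1 / (2 ^ l * (l.factorial : ℂ))) * derivative^[l] ((X ^ 2 - 1) ^ l)

theorem legP_eq_eval (l : ℕ) (z : ℂ) : legP l z = (legendrePoly l).eval z := by
  have h (q : ℂ[X]) (m : ℕ) :
      iteratedDeriv m (fun w => q.eval w) = fun w => (derivative^[m] q).eval w := by
    induction m with
    | zero => simp
    | succ m ih =>
      rw [iteratedDeriv_succ, ih, Function.iterate_succ_apply']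
      funext w
      exact Polynomial.deriv _
  have h' := congrFun (h ((X ^ 2 - 1) ^ l) l) z
  simp only [eval_pow, eval_sub, eval_X, eval_one] at h'
  rw [legP, h', legendrePoly, eval_mul, eval_C]

theorem natDegree_legendrePoly_le (l : ℕ) : (legendrePoly l).natDegree ≤ l := by
  refine (natDegree_C_mul_le _ _).trans ((natDegree_iterate_derivative _ _).trans ?_)
  have h : (((X ^ 2 - 1) ^ l : ℂ[X])).natDegree ≤ l * 2 := by
    refine natDegree_pow_le_of_le l ?_
    compute_degree
  omega

theorem iterate_derivative_rodrigues (l m : ℕ) :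
    (X ^ 2 - 1) * derivative^[m + 2] ((X ^ 2 - 1) ^ l : ℂ[X]) +
      2 * ((m : ℂ[X]) + 1 - (l : ℂ[X])) * X * derivative^[m + 1] ((X ^ 2 - 1) ^ l) +
      ((m : ℂ[X]) + 1) * ((m : ℂ[X]) - 2 * (l : ℂ[X])) * derivative^[m] ((X ^ 2 - 1) ^ l) = 0 := by
  induction m with
  | zero =>
    have h : (X ^ 2 - 1) * derivative ((X ^ 2 - 1) ^ l : ℂ[X]) =
        2 * (l : ℂ[X]) * X * (X ^ 2 - 1) ^ l := by
      cases l with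
      | zero => simp
      | succ l =>
        simp only [derivative_pow, derivative_sub, derivative_one, derivative_X, map_natCast,
          Nat.cast_add, Nat.cast_one, Nat.add_sub_cancel]
        simp
        ring
    have h' := congrArg derivative h
    simp only [derivative_mul, derivative_sub, derivative_one, derivative_X_pow, derivative_X,
      derivative_natCast, derivative_ofNat, map_natCast] at h'
    simp only [zero_add, Function.iterate_succ_apply', Function.iterate_zero_apply,
      Nat.cast_zero]
    push_cast at h'
    linear_combination h'
  | succ m ih =>
    have h' := congrArg derivative ih
    simp only [derivative_mul, derivative_add, derivative_sub, derivative_one, derivative_X_pow,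
      derivative_X, derivative_natCast, derivative_ofNat, derivative_zero, map_natCast,
      ← Function.iterate_succ_apply' derivative] at h'
    push_cast at h' ⊢
    simp only [Nat.succ_eq_add_one, add_assoc, Nat.reduceAdd] at h' ⊢
    linear_combination h'

theorem legendrePoly_ode (l : ℕ) :
    (X ^ 2 - 1) * derivative (derivative (legendrePoly l)) +
      2 * X * derivative (legendrePoly l) = ((l : ℂ[X]) * ((l : ℂ[X]) + 1)) * legendrePoly l := by
  have h := iterate_derivative_rodrigues l l
  simp only [legendrePoly, derivative_C_mul, ← Function.iterate_succ_apply' derivative,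
    Nat.succ_eq_add_one, add_assoc, Nat.reduceAdd] at h ⊢
  linear_combination C (1 / (2 ^ l * (l.factorial : ℂ))) * h

/-- The Legendre polynomial on the imaginary axis, as a polynomial in the real coordinate. -/
noncomputable def legendrePolyImag (l : ℕ) : ℂ[X] :=
  (legendrePoly l).comp (C Complex.I * X)

theorem natDegree_legendrePolyImag_le (l : ℕ) : (legendrePolyImag l).natDegree ≤ l := by
  refine natDegree_comp_le.trans ?_
  have h : (C Complex.I * X : ℂ[X]).natDegree ≤ 1 := by compute_degree
  calc _ ≤ l * 1 := Nat.mul_le_mul (natDegree_legendrePoly_le l) h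
    _ = l := mul_one l

theorem legendrePolyImag_ode (l : ℕ) :
    (1 + X ^ 2) * derivative (derivative (legendrePolyImag l)) +
      2 * X * derivative (legendrePolyImag l) =
    ((l : ℂ[X]) * ((l : ℂ[X]) + 1)) * legendrePolyImag l := by
  have h := congrArg (fun q : ℂ[X] => q.comp (C Complex.I * X)) (legendrePoly_ode l)
  have hI : (C Complex.I : ℂ[X]) ^ 2 = -1 := by
    rw [← C_pow, Complex.I_sq]; simp
  simp only [add_comp, mul_comp, sub_comp, pow_comp, X_comp, one_comp, natCast_comp,
    ofNat_comp] at h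
  simp only [legendrePolyImag, derivative_comp, derivative_mul, derivative_C, derivative_X,
    zero_mul, zero_add, mul_one]
  linear_combination h + ((derivative (derivative (legendrePoly l))).comp (C Complex.I * X)) * hI

theorem hasDerivAt_eval_ofReal (q : ℂ[X]) (x : ℝ) :
    HasDerivAt (fun t : ℝ => q.eval (t : ℂ)) ((derivative q).eval (x : ℂ)) x :=
  (q.hasDerivAt (x : ℂ)).comp_ofReal

theorem contDiff_eval_ofReal (q : ℂ[X]) : ContDiff ℝ ⊤ (fun t : ℝ => q.eval (t : ℂ)) := by
  simp only [eval_eq_sum_range]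
  refine ContDiff.sum fun i _ => contDiff_const.mul (Complex.ofRealCLM.contDiff.pow i)

theorem iteratedDeriv_eval_ofReal (q : ℂ[X]) (m : ℕ) :
    iteratedDeriv m (fun t : ℝ => q.eval (t : ℂ)) =
      fun t : ℝ => (derivative^[m] q).eval (t : ℂ) := by
  induction m with
  | zero => simp
  | succ m ih =>
    rw [iteratedDeriv_succ, ih, Function.iterate_succ_apply']
    funext x
    exact (hasDerivAt_eval_ofReal _ x).deriv

theorem exists_legQ_imag_eq (l : ℕ) : ∃ w : ℂ[X], w.natDegree ≤ l ∧
    (fun t : ℝ => legQ l (Complex.I * t)) = fun t : ℝ =>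
      Complex.I * ((legendrePolyImag l).eval (t : ℂ) * (Real.arctan t : ℂ)) - w.eval (t : ℂ) := by
  refine ⟨∑ j ∈ Finset.Icc 1 l,
    C ((j : ℂ)⁻¹) * (legendrePolyImag (j - 1) * legendrePolyImag (l - j)), ?_, ?_⟩
  · refine natDegree_sum_le_of_forall_le _ _ fun j hj => ?_
    rw [Finset.mem_Icc] at hj
    refine (natDegree_C_mul_le _ _).trans (natDegree_mul_le.trans ?_)
    have h1 := natDegree_legendrePolyImag_le (j - 1)
    have h2 := natDegree_legendrePolyImag_le (l - j)
    omega
  · funext t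
    have harctan : Complex.log ((1 + Complex.I * t) / (1 - Complex.I * t)) =
        2 * Complex.I * (Real.arctan t : ℂ) := by
      rw [Complex.ofReal_arctan, Complex.arctan, mul_comm Complex.I]
      linear_combination Complex.log ((1 + t * Complex.I) / (1 - t * Complex.I)) * Complex.I_sq
    simp only [legQ, legP_eq_eval, harctan, legendrePolyImag, eval_finsetSum, eval_mul, eval_C,
      eval_comp, eval_X]
    congr 1
    · ring
    · exact Finset.sum_congr rfl fun j _ => by ring

theorem contDiff_eval_mul_arctan (q : ℂ[X]) :
    ContDiff ℝ ⊤ (fun t : ℝ => q.eval (t : ℂ) * (Real.arctan t : ℂ)) :=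
  (contDiff_eval_ofReal q).mul (Complex.ofRealCLM.contDiff.comp Real.contDiff_arctan)

theorem one_add_sq_ofReal_ne_zero (x : ℝ) : (1 + (x : ℂ) ^ 2) ≠ 0 := by
  have h : (1 + x ^ 2 : ℝ) ≠ 0 := by positivity
  exact_mod_cast h

theorem hasDerivAt_iteratedDeriv {f : ℝ → ℂ} (hf : ContDiff ℝ ⊤ f) (m : ℕ) (x : ℝ) :
    HasDerivAt (iteratedDeriv m f) (iteratedDeriv (m + 1) f x) x := by
  rw [iteratedDeriv_succ]
  exact ((hf.differentiable_iteratedDeriv m (by exact_mod_cast WithTop.coe_lt_top _)) x).hasDerivAt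

/-- Differentiating the Legendre equation on the imaginary axis `m` times. -/
theorem iteratedDeriv_legendre_ode {f : ℝ → ℂ} (hf : ContDiff ℝ ⊤ f) (a : ℂ) (g : ℂ[X])
    (h : ∀ x : ℝ, (1 + (x : ℂ) ^ 2) * iteratedDeriv 2 f x + 2 * x * iteratedDeriv 1 f x
      - a * f x = g.eval (x : ℂ)) (m : ℕ) (x : ℝ) :
    (1 + (x : ℂ) ^ 2) * iteratedDeriv (m + 2) f x + 2 * (m + 1) * x * iteratedDeriv (m + 1) f x
      + (m * (m + 1) - a) * iteratedDeriv m f x = (derivative^[m] g).eval (x : ℂ) := by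
  induction m generalizing x with
  | zero =>
    have := h x
    simp only [zero_add, iteratedDeriv_zero, Function.iterate_zero_apply, Nat.cast_zero]
    linear_combination this
  | succ m ih =>
    have hx : HasDerivAt (fun t : ℝ => (t : ℂ)) 1 x := (hasDerivAt_id x).ofReal_comp
    have d := ((((hx.fun_pow 2).const_add 1).fun_mul
      (hasDerivAt_iteratedDeriv hf (m + 2) x)).fun_add
      ((hx.const_mul (2 * ((m : ℂ) + 1))).fun_mul (hasDerivAt_iteratedDeriv hf (m + 1) x))).fun_add
      ((hasDerivAt_iteratedDeriv hf m x).const_mul (m * ((m : ℂ) + 1) - a))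
    have e := d.unique (((hasDerivAt_eval_ofReal (derivative^[m] g) x)).congr_of_eventuallyEq
      (Filter.Eventually.of_forall fun y => ih y))
    rw [Function.iterate_succ_apply', ← e]
    push_cast
    simp only [add_assoc, Nat.reduceAdd]
    ring

theorem eval_mul_arctan_ode (l : ℕ) (x : ℝ) :
    (1 + (x : ℂ) ^ 2) * iteratedDeriv 2
        (fun t : ℝ => (legendrePolyImag l).eval (t : ℂ) * (Real.arctan t : ℂ)) x +
      2 * x * iteratedDeriv 1
        (fun t : ℝ => (legendrePolyImag l).eval (t : ℂ) * (Real.arctan t : ℂ)) x -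
      l * (l + 1) * ((legendrePolyImag l).eval (x : ℂ) * (Real.arctan x : ℂ)) =
    (2 * derivative (legendrePolyImag l)).eval (x : ℂ) := by
  set p := legendrePolyImag l with hp
  have harctan (y : ℝ) : HasDerivAt (fun t : ℝ => (Real.arctan t : ℂ)) (1 + (y : ℂ) ^ 2)⁻¹ y := by
    have := (Real.hasDerivAt_arctan y).ofReal_comp
    simpa using this
  have hx : HasDerivAt (fun t : ℝ => (t : ℂ)) 1 x := (hasDerivAt_id x).ofReal_comp
  have h1 : iteratedDeriv 1 (fun t : ℝ => p.eval (t : ℂ) * (Real.arctan t : ℂ)) =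
      fun t : ℝ => (derivative p).eval (t : ℂ) * (Real.arctan t : ℂ) +
        p.eval (t : ℂ) * (1 + (t : ℂ) ^ 2)⁻¹ := by
    rw [iteratedDeriv_one]
    funext y
    exact ((hasDerivAt_eval_ofReal p y).fun_mul (harctan y)).deriv
  have h2 := (((hasDerivAt_eval_ofReal (derivative p) x).fun_mul (harctan x)).fun_add
    ((hasDerivAt_eval_ofReal p x).fun_mul
      (((hx.fun_pow 2).const_add 1).fun_inv (one_add_sq_ofReal_ne_zero x)))).deriv
  have hode := congrArg (fun q : ℂ[X] => q.eval (x : ℂ)) (legendrePolyImag_ode l)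
  simp only [eval_add, eval_mul, eval_pow, eval_X, eval_one, eval_natCast, eval_ofNat,
    ← hp] at hode
  rw [iteratedDeriv_succ (n := 1), h1, h2]
  have hne := one_add_sq_ofReal_ne_zero x
  simp only [eval_mul, eval_ofNat]
  field_simp
  push_cast [-Complex.ofReal_arctan]
  linear_combination (1 + (x : ℂ) ^ 2) * (Real.arctan x : ℂ) * hode

theorem exists_iteratedDeriv_succ_legQ_imag (l : ℕ) : ∃ c : ℂ,
    iteratedDeriv (l + 1) (fun t : ℝ => legQ l (Complex.I * t)) =
      fun x : ℝ => c * (((1 + x ^ 2) ^ (l + 1))⁻¹ : ℝ) := by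
  obtain ⟨w, hw, hQ⟩ := exists_legQ_imag_eq l
  set f : ℝ → ℂ := fun t => (legendrePolyImag l).eval (t : ℂ) * (Real.arctan t : ℂ) with hf
  have hfs : ContDiff ℝ ⊤ f := contDiff_eval_mul_arctan _
  have hode (x : ℝ) := iteratedDeriv_legendre_ode hfs (l * (l + 1)) _ (eval_mul_arctan_ode l) l x
  have hzero : derivative^[l] (2 * derivative (legendrePolyImag l)) = 0 := by
    have h2 : (2 : ℂ[X]) = C 2 := rfl
    rw [h2, ← smul_eq_C_mul, Polynomial.iterate_derivative_smul,
      ← Function.iterate_succ_apply derivative,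
      iterate_derivative_eq_zero (Nat.lt_succ_of_le (natDegree_legendrePolyImag_le l)), smul_zero]
  have hder (x : ℝ) : HasDerivAt
      (fun t : ℝ => (1 + (t : ℂ) ^ 2) ^ (l + 1) * iteratedDeriv (l + 1) f t) 0 x := by
    have hx : HasDerivAt (fun t : ℝ => (t : ℂ)) 1 x := (hasDerivAt_id x).ofReal_comp
    refine ((((hx.fun_pow 2).const_add 1).fun_pow (l + 1)).fun_mul
      (hasDerivAt_iteratedDeriv hfs (l + 1) x)).congr_deriv ?_
    have := hode x
    rw [hzero, eval_zero] at this
    push_cast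
    linear_combination (1 + (x : ℂ) ^ 2) ^ l * this
  have hconst (x : ℝ) := is_const_of_deriv_eq_zero (fun y => (hder y).differentiableAt)
    (fun y => (hder y).deriv) x 0
  refine ⟨Complex.I * iteratedDeriv (l + 1) f 0, ?_⟩
  funext x
  rw [hQ]
  have h1 : iteratedDeriv (l + 1) (fun t : ℝ => Complex.I * f t - w.eval (t : ℂ)) x =
      Complex.I * iteratedDeriv (l + 1) f x := by
    have := iteratedDeriv_fun_sub (n := l + 1) (x := x)
      ((contDiff_const (c := Complex.I)).mul hfs |>.of_le le_top).contDiffAt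
      ((contDiff_eval_ofReal w).of_le le_top).contDiffAt
    rw [this, iteratedDeriv_eval_ofReal, iterate_derivative_eq_zero (Nat.lt_succ_of_le hw)]
    simp only [eval_zero, sub_zero, iteratedDeriv_const_mul_field]
  rw [h1]
  have := hconst x
  have hne := one_add_sq_ofReal_ne_zero x
  simp only [Complex.ofReal_zero, ne_eq, OfNat.ofNat_ne_zero, not_false_eq_true, zero_pow,
    add_zero, one_pow, one_mul] at this
  rw [← this]
  push_cast
  field_simp

theorem hasDerivAt_eval_div_one_add_sq_pow (p : ℝ[X]) (m : ℕ) (x : ℝ) :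
    HasDerivAt (fun t : ℝ => p.eval t / (1 + t ^ 2) ^ m)
      ((derivative p * (1 + X ^ 2) - (2 * m : ℝ[X]) * X * p).eval x /
        (1 + x ^ 2) ^ (m + 1)) x := by
  have hne : (1 + x ^ 2) ≠ 0 := by positivity
  have h := (p.hasDerivAt x).fun_div ((((hasDerivAt_id' x).fun_pow 2).const_add 1).fun_pow m)
    (pow_ne_zero m hne)
  refine h.congr_deriv ?_
  cases m with
  | zero => simp; field_simp
  | succ m =>
    simp
    field_simp
    ring

theorem exists_iteratedDeriv_legQ_imag (l m : ℕ) : ∃ c : ℂ, ∃ p : ℝ[X], p.natDegree ≤ m ∧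
    iteratedDeriv (l + 1 + m) (fun t : ℝ => legQ l (Complex.I * t)) =
      fun x : ℝ => c * ((p.eval x / (1 + x ^ 2) ^ (l + 1 + m) : ℝ) : ℂ) := by
  obtain ⟨c, hc⟩ := exists_iteratedDeriv_succ_legQ_imag l
  refine ⟨c, ?_⟩
  induction m with
  | zero => exact ⟨1, by simp, by simpa using hc⟩
  | succ m ih =>
    obtain ⟨p, hp, h⟩ := ih
    refine ⟨derivative p * (1 + X ^ 2) - (2 * ((l + 1 + m : ℕ) : ℝ[X])) * X * p, ?_, ?_⟩
    · have hd : (1 + X ^ 2 : ℝ[X]).natDegree ≤ 2 := by compute_degree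
      have hX : ((2 * ((l + 1 + m : ℕ) : ℝ[X])) * X).natDegree ≤ 1 := by
        rw [show (2 * ((l + 1 + m : ℕ) : ℝ[X])) = C (2 * (l + 1 + m : ℕ) : ℝ) by
          rw [C_mul, map_natCast]; rfl]
        compute_degree
      refine (natDegree_sub_le_of_le (m := m + 1) ?_
        ((natDegree_mul_le_of_le hX hp).trans (Nat.add_comm 1 m).le)).trans (max_self _).le
      rcases Nat.eq_zero_or_pos p.natDegree with h0 | h0
      · rw [eq_C_of_natDegree_eq_zero h0]; simp
      · have := natDegree_derivative_lt h0.ne'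
        exact (natDegree_mul_le_of_le (m := m - 1) (by omega) hd).trans (by omega)
    · rw [← add_assoc, iteratedDeriv_succ, h]
      funext x
      exact (((hasDerivAt_eval_div_one_add_sq_pow p _ x).ofReal_comp).const_mul c).deriv

theorem degree_wronskian_lt {p q : ℝ[X]} {a b : ℕ} (hp : p.natDegree ≤ a) (hq : q.natDegree ≤ b) :
    (q * derivative p - p * derivative q).degree < ((a + b : ℕ) : WithBot ℕ) ∨
      q * derivative p - p * derivative q = 0 := by
  by_cases h : a + b = 0
  · right
    rw [eq_C_of_natDegree_eq_zero (p := p) (by omega),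
      eq_C_of_natDegree_eq_zero (p := q) (by omega)]
    simp
  · left
    have key {r s : ℝ[X]} {c d : ℕ} (hr : r.natDegree ≤ c) (hs : s.natDegree ≤ d)
        (hcd : c + d ≠ 0) : (r * derivative s).degree < ((c + d : ℕ) : WithBot ℕ) := by
      rcases Nat.eq_zero_or_pos s.natDegree with h0 | h0
      · rw [eq_C_of_natDegree_eq_zero h0]; simp
      · have := natDegree_derivative_lt h0.ne'
        refine degree_le_natDegree.trans_lt ?_
        exact_mod_cast natDegree_mul_le.trans_lt (by omega)
    refine (degree_sub_le _ _).trans_lt (max_lt ?_ (key hp hq h))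
    rw [add_comm a b]
    exact key hq hp (by omega)

theorem tendsto_eval_div_one_add_sq_pow {r : ℝ[X]} {m : ℕ}
    (h : r.degree < ((2 * m : ℕ) : WithBot ℕ)) :
    Tendsto (fun x : ℝ => r.eval x / (1 + x ^ 2) ^ m) atTop (nhds 0) ∧
      Tendsto (fun x : ℝ => r.eval x / (1 + x ^ 2) ^ m) atBot (nhds 0) := by
  have hdeg : ((1 + X ^ 2) ^ m : ℝ[X]).degree = ((2 * m : ℕ) : WithBot ℕ) := by
    rw [degree_pow, show (1 + X ^ 2 : ℝ[X]).degree = 2 by compute_degree!]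
    rw [nsmul_eq_mul, mul_comm]; norm_cast
  have key {s : ℝ[X]} (hs : s.degree < ((2 * m : ℕ) : WithBot ℕ)) :
      Tendsto (fun x : ℝ => s.eval x / (1 + x ^ 2) ^ m) atTop (nhds 0) := by
    have := div_tendsto_atTop_zero_of_degree_lt s ((1 + X ^ 2) ^ m) (hs.trans_eq hdeg.symm)
    simpa using this
  refine ⟨key h, ?_⟩
  have hneg : (r.comp (-X)).degree < ((2 * m : ℕ) : WithBot ℕ) := by
    rwa [degree_comp_neg_X]
  have := (key hneg).comp tendsto_neg_atBot_atTop
  refine this.congr fun x => ?_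
  simp

theorem boundary_term_eq {k l n : ℕ} {c d : ℂ} {p q : ℝ[X]}
    (hp : iteratedDeriv k (fun t : ℝ => legQ l (Complex.I * t)) =
      fun x : ℝ => c * ((p.eval x / (1 + x ^ 2) ^ k : ℝ) : ℂ))
    (hq : iteratedDeriv k (fun t : ℝ => legQ n (Complex.I * t)) =
      fun x : ℝ => d * ((q.eval x / (1 + x ^ 2) ^ k : ℝ) : ℂ)) (hk : 0 < k) (x : ℝ) :
    ((1 + x ^ 2 : ℝ) : ℂ) * ((Qi k n x) * deriv (fun t : ℝ => Qi k l t) x -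
        (Qi k l x) * deriv (fun t : ℝ => Qi k n t) x) =
      ((-1) ^ k * Complex.I ^ (-(k : ℤ))) ^ 2 * c * d *
        (((q * derivative p - p * derivative q).eval x / (1 + x ^ 2) ^ (k - 1) : ℝ) : ℂ) := by
  have hpos (y : ℝ) : 0 < 1 + y ^ 2 := by positivity
  have hφ : DifferentiableAt ℝ (fun t : ℝ => (1 + t ^ 2) ^ ((k : ℝ) / 2)) x :=
    DifferentiableAt.rpow_const (by fun_prop) (Or.inl (hpos x).ne')
  have hsq : ((1 + x ^ 2) ^ ((k : ℝ) / 2)) ^ 2 = (1 + x ^ 2) ^ k := by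
    rw [← Real.rpow_natCast, ← Real.rpow_mul (hpos x).le, ← Real.rpow_natCast (1 + x ^ 2)]
    congr 1
    push_cast
    ring
  have hQi (j : ℕ) (b : ℂ) (r : ℝ[X])
      (h : iteratedDeriv k (fun t : ℝ => legQ j (Complex.I * t)) =
        fun x : ℝ => b * ((r.eval x / (1 + x ^ 2) ^ k : ℝ) : ℂ)) (y : ℝ) :
      Qi k j y = (-1) ^ k * Complex.I ^ (-(k : ℤ)) * b *
        (((1 + y ^ 2) ^ ((k : ℝ) / 2) * (r.eval y / (1 + y ^ 2) ^ k) : ℝ) : ℂ) := by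
    rw [Qi, h]
    push_cast
    ring
  have hd (b : ℂ) (r : ℝ[X]) := ((hφ.hasDerivAt.fun_mul
    (hasDerivAt_eval_div_one_add_sq_pow r k x)).ofReal_comp.const_mul
      ((-1) ^ k * Complex.I ^ (-(k : ℤ)) * b)).deriv
  simp only [hQi l c p hp, hQi n d q hq, hd]
  set φ := (1 + x ^ 2) ^ ((k : ℝ) / 2)
  set φ' := deriv (fun t : ℝ => (1 + t ^ 2) ^ ((k : ℝ) / 2)) x
  have hreal : (1 + x ^ 2) * (φ * (q.eval x / (1 + x ^ 2) ^ k) *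
      (φ' * (p.eval x / (1 + x ^ 2) ^ k) + φ *
        ((derivative p * (1 + X ^ 2) - (2 * k : ℝ[X]) * X * p).eval x / (1 + x ^ 2) ^ (k + 1))) -
      φ * (p.eval x / (1 + x ^ 2) ^ k) *
      (φ' * (q.eval x / (1 + x ^ 2) ^ k) + φ *
        ((derivative q * (1 + X ^ 2) - (2 * k : ℝ[X]) * X * q).eval x / (1 + x ^ 2) ^ (k + 1)))) =
      (q * derivative p - p * derivative q).eval x / (1 + x ^ 2) ^ (k - 1) := by
    obtain ⟨m, rfl⟩ := Nat.exists_eq_add_of_lt hk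
    have hne := (hpos x).ne'
    simp only [eval_sub, eval_mul, eval_add, eval_pow, eval_X, eval_one, eval_natCast, eval_ofNat,
      zero_add, Nat.add_sub_cancel] at hsq ⊢
    generalize 1 + x ^ 2 = s at *
    have e : s * (φ * (q.eval x / s ^ (m + 1)) *
      (φ' * (p.eval x / s ^ (m + 1)) + φ *
        (((derivative p).eval x * s - 2 * (m + 1 : ℕ) * x * p.eval x) / s ^ (m + 1 + 1))) -
      φ * (p.eval x / s ^ (m + 1)) *
      (φ' * (q.eval x / s ^ (m + 1)) + φ *
        (((derivative q).eval x * s - 2 * (m + 1 : ℕ) * x * q.eval x) / s ^ (m + 1 + 1)))) =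
      φ ^ 2 * (q.eval x * (derivative p).eval x - p.eval x * (derivative q).eval x) *
        s / (s ^ (m + 1)) ^ 2 := by
      field_simp
      ring
    rw [e, hsq]
    field_simp
    ring
  rw [← hreal]
  push_cast
  ring

/-- The boundary term of the Lagrange identity vanishes at infinity. -/
theorem legendreQ_imag_boundary_term_vanishes (k l n : ℕ) (hl : l < k) (hn : n < k) :
    Tendsto (fun x : ℝ => ((1 + x ^ 2 : ℝ) : ℂ) *
        ((Qi k n x) * deriv (fun t : ℝ => Qi k l t) x -
          (Qi k l x) * deriv (fun t : ℝ => Qi k n t) x)) atTop (nhds 0) ∧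
      Tendsto (fun x : ℝ => ((1 + x ^ 2 : ℝ) : ℂ) *
        ((Qi k n x) * deriv (fun t : ℝ => Qi k l t) x -
          (Qi k l x) * deriv (fun t : ℝ => Qi k n t) x)) atBot (nhds 0) := by
  have hk : 0 < k := by omega
  obtain ⟨c, p, hp, hlp⟩ := exists_iteratedDeriv_legQ_imag l (k - l - 1)
  obtain ⟨d, q, hq, hnq⟩ := exists_iteratedDeriv_legQ_imag n (k - n - 1)
  rw [show l + 1 + (k - l - 1) = k by omega] at hlp
  rw [show n + 1 + (k - n - 1) = k by omega] at hnq
  have hdeg : (q * derivative p - p * derivative q).degree < ((2 * (k - 1) : ℕ) : WithBot ℕ) := by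
    rcases degree_wronskian_lt hp hq with h | h
    · refine h.trans_le ?_
      exact_mod_cast (by omega : k - l - 1 + (k - n - 1) ≤ 2 * (k - 1))
    · rw [h, degree_zero]
      exact WithBot.bot_lt_coe _
  have hlim := tendsto_eval_div_one_add_sq_pow hdeg
  simp only [boundary_term_eq hlp hnq hk]
  constructor
  · simpa using ((Complex.continuous_ofReal.tendsto 0).comp hlim.1).const_mul
      (((-1) ^ k * Complex.I ^ (-(k : ℤ))) ^ 2 * c * d)
  · simpa using ((Complex.continuous_ofReal.tendsto 0).comp hlim.2).const_mul
      (((-1) ^ k * Complex.I ^ (-(k : ℤ))) ^ 2 * c * d)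
end

section
/- Let k, ℓ be natural numbers with ℓ < k. Then for every x ∈ ℝ the complex conjugate of Q^k_ℓ(i·x) equals (−1)^{k−ℓ−1}·Q^k_ℓ(i·x); in particular Q^k_ℓ(i·x) is real-valued when k−ℓ−1 is even and purely imaginary when k−ℓ−1 is odd. -/
open MeasureTheory Filter Finset

theorem iteratedDeriv_conj_real (n : ℕ) (f : ℝ → ℂ) (x : ℝ) :
    iteratedDeriv n (fun t => starRingEnd ℂ (f t)) x = starRingEnd ℂ (iteratedDeriv n f x) := by
  induction n generalizing x with
  | zero => simp
  | succ n ih =>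
    rw [iteratedDeriv_succ, iteratedDeriv_succ, funext ih]
    exact deriv.star

theorem iteratedDeriv_conj_conj (n : ℕ) (f : ℂ → ℂ) (z : ℂ) :
    iteratedDeriv n (fun w => starRingEnd ℂ (f (starRingEnd ℂ w))) z =
      starRingEnd ℂ (iteratedDeriv n f (starRingEnd ℂ z)) := by
  induction n generalizing z with
  | zero => simp
  | succ n ih =>
    rw [iteratedDeriv_succ, iteratedDeriv_succ, funext ih]
    exact congrFun (deriv_conj_conj (f := iteratedDeriv n f)) z

theorem legP_conj (l : ℕ) (z : ℂ) :
    starRingEnd ℂ (legP l z) = legP l (starRingEnd ℂ z) := by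
  have h := iteratedDeriv_conj_conj l (fun w : ℂ => (w ^ 2 - 1) ^ l) (starRingEnd ℂ z)
  simp only [map_pow, map_sub, map_one, Complex.conj_conj] at h
  simp only [legP, map_mul, map_div₀, map_pow, map_one, map_ofNat, map_natCast, h]

theorem legP_neg (l : ℕ) (z : ℂ) : legP l (-z) = (-1) ^ l * legP l z := by
  have h := iteratedDeriv_comp_neg l (fun w : ℂ => (w ^ 2 - 1) ^ l) (-z)
  simp only [even_two.neg_pow, neg_neg, smul_eq_mul] at h
  rw [legP, legP, h]
  ring

theorem legP_imag_conj (l : ℕ) (t : ℝ) :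
    starRingEnd ℂ (legP l (Complex.I * t)) = (-1) ^ l * legP l (Complex.I * t) := by
  rw [legP_conj, ← legP_neg]
  simp

theorem log_cayley_imag_conj (t : ℝ) :
    starRingEnd ℂ (Complex.log ((1 + Complex.I * t) / (1 - Complex.I * t))) =
      -Complex.log ((1 + Complex.I * t) / (1 - Complex.I * t)) := by
  have hc : 1 - Complex.I * t = starRingEnd ℂ (1 + Complex.I * t) := by simp [sub_eq_add_neg]
  have hne : 1 + Complex.I * t ≠ 0 := fun h => by simpa using congrArg Complex.re h
  have hre : (Complex.log ((1 + Complex.I * t) / (1 - Complex.I * t))).re = 0 := by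
    rw [Complex.log_re, hc, norm_div, Complex.norm_conj, div_self (norm_ne_zero_iff.mpr hne),
      Real.log_one]
  apply Complex.ext <;> simp [hre]

theorem legQ_imag_conj (l : ℕ) (t : ℝ) :
    starRingEnd ℂ (legQ l (Complex.I * t)) = (-1) ^ (l + 1) * legQ l (Complex.I * t) := by
  rw [legQ, map_sub, map_sum, mul_sub, Finset.mul_sum]
  congr 1
  · simp only [map_mul, legP_imag_conj, log_cayley_imag_conj, map_div₀, map_one, map_ofNat]
    ring
  · refine Finset.sum_congr rfl fun j hj => ?_
    obtain ⟨h1, h2⟩ := Finset.mem_Icc.mp hj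
    simp only [map_div₀, map_mul, legP_imag_conj, map_natCast]
    have hp : (-1 : ℂ) ^ (l + 1) = (-1) ^ (j - 1) * (-1) ^ (l - j) := by
      rw [← pow_add, show l + 1 = j - 1 + (l - j) + 2 by lia, pow_add _ _ 2]
      simp
    rw [hp]
    ring

/-- Reality properties: the conjugate of `Q^k_ℓ(i·x)` is `(−1)^{k−ℓ−1} Q^k_ℓ(i·x)`. -/
theorem legendreQ_imag_conj (k l : ℕ) (hl : l < k) (x : ℝ) :
    (starRingEnd ℂ) (Qi k l x) = (-1 : ℂ) ^ (k - l - 1) * Qi k l x := by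
  have hd : starRingEnd ℂ (iteratedDeriv k (fun t : ℝ => legQ l (Complex.I * t)) x) =
      (-1) ^ (l + 1) * iteratedDeriv k (fun t : ℝ => legQ l (Complex.I * t)) x := by
    rw [← iteratedDeriv_conj_real, funext (legQ_imag_conj l), iteratedDeriv_const_mul_field]
  have hI : starRingEnd ℂ (Complex.I ^ (-(k : ℤ))) = (-1) ^ k * Complex.I ^ (-(k : ℤ)) := by
    rw [map_zpow₀, Complex.conj_I, zpow_neg, zpow_neg, zpow_natCast, zpow_natCast,
      neg_pow Complex.I, mul_inv, ← inv_pow, inv_neg_one]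
  have hp : (-1 : ℂ) ^ k * (-1) ^ (l + 1) = (-1) ^ (k - l - 1) := by
    rw [← pow_add, show k + (l + 1) = k - l - 1 + 2 * (l + 1) by lia, pow_add, pow_mul]
    simp
  rw [← hp, Qi]
  simp only [map_mul, map_pow, map_neg, map_one, Complex.conj_ofReal, hd, hI]
  ring
end
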